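/- arXiv:1812.03427 — 3 statements merged into one kernel-verified Lean document; each statement's English description precedes it below -/
import Mathlib

section
/- The subfield of the rational function field ℂ(x_1,…,x_n) generated over ℂ by the n elements y_1, y_2, …, y_n equals the whole field ℂ(x_1,…,x_n). (In other words, the assignment x_i ↦ y_i induces an isomorphism ℂ(y_1,…,y_n) ≅ ℂ(x_1,…,x_n), so the polynomial map x ↦ (y_1(x),…,y_n(x)) is birational.) -/
open MvPolynomial

namespace MvPolynomial

variable {σ k L : Type*} [Field k] [Field L] [Algebra k L]
  [Algebra (MvPolynomial σ k) L] [IsScalarTower k (MvPolynomial σ k) L]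

theorem algebraMap_mem_intermediateField_of_mem_supported (K : IntermediateField k L)
    {s : Set σ} (hs : ∀ i ∈ s, algebraMap (MvPolynomial σ k) L (X i) ∈ K)
    {p : MvPolynomial σ k} (hp : p ∈ supported k s) :
    algebraMap (MvPolynomial σ k) L p ∈ K := by
  have hle : supported k s ≤
      K.toSubalgebra.comap (IsScalarTower.toAlgHom k (MvPolynomial σ k) L) := by
    refine Algebra.adjoin_le ?_
    rintro _ ⟨i, hi, rfl⟩
    exact hs i hi
  exact hle hp

theorem intermediateField_eq_top_of_algebraMap_X_mem [IsFractionRing (MvPolynomial σ k) L]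
    (K : IntermediateField k L) (hX : ∀ i, algebraMap (MvPolynomial σ k) L (X i) ∈ K) :
    K = ⊤ := by
  have hK (p : MvPolynomial σ k) : algebraMap (MvPolynomial σ k) L p ∈ K :=
    algebraMap_mem_intermediateField_of_mem_supported K (s := Set.univ) (fun i _ ↦ hX i)
      (by simp [supported_univ])
  refine eq_top_iff.2 fun z _ ↦ ?_
  obtain ⟨a, b, -, rfl⟩ := IsFractionRing.div_surjective (A := MvPolynomial σ k) z
  exact K.div_mem (hK a) (hK b)

theorem one_add_X_sq_ne_zero {R : Type*} [CommSemiring R] [Nontrivial R] (i : σ) :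
    (1 + X i ^ 2 : MvPolynomial σ R) ≠ 0 := fun h ↦ by
  simpa using congrArg (eval 0) h

end MvPolynomial

/-- Let `n ≥ 4`, let `F₃ ∈ ℂ[x₃,…,xₙ]` be homogeneous of degree 3
(depending only on the variables `x₃,…,xₙ`, i.e. with 0-based indices `≥ 2`), set
`F := x₁·x₃² + x₂²·x₄ + F₃`, and define `y₁ := x₁ + F`, `y₂ := x₂`, `yⱼ := x₂·xⱼ`
for `3 ≤ j ≤ n`.  Then the subfield of `ℂ(x₁,…,xₙ)` generated over `ℂ` by
`y₁,…,yₙ` is the whole field `ℂ(x₁,…,xₙ)`. -/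
theorem statement0 (n : ℕ) (hn : 4 ≤ n)
    (F3 : MvPolynomial (Fin n) ℂ)
    (hF3hom : F3.IsHomogeneous 3)
    (hF3supp : F3 ∈ MvPolynomial.supported ℂ {i : Fin n | 2 ≤ (i : ℕ)})
    (F : MvPolynomial (Fin n) ℂ)
    (hF : F = X ⟨0, by omega⟩ * X ⟨2, by omega⟩ ^ 2
            + X ⟨1, by omega⟩ ^ 2 * X ⟨3, by omega⟩ + F3)
    (y : Fin n → MvPolynomial (Fin n) ℂ)
    (hy0 : y ⟨0, by omega⟩ = X ⟨0, by omega⟩ + F)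
    (hy1 : y ⟨1, by omega⟩ = X ⟨1, by omega⟩)
    (hyj : ∀ j : Fin n, 2 ≤ (j : ℕ) → y j = X ⟨1, by omega⟩ * X j) :
    IntermediateField.adjoin ℂ
      (Set.range fun i : Fin n =>
        algebraMap (MvPolynomial (Fin n) ℂ) (FractionRing (MvPolynomial (Fin n) ℂ)) (y i))
      = ⊤ := by
  set φ := algebraMap (MvPolynomial (Fin n) ℂ) (FractionRing (MvPolynomial (Fin n) ℂ))
  set K := IntermediateField.adjoin ℂ (Set.range fun i : Fin n => φ (y i))
  have hφ {p : MvPolynomial (Fin n) ℂ} (hp : p ≠ 0) : φ p ≠ 0 :=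
    (map_ne_zero_iff φ (IsFractionRing.injective _ _)).2 hp
  have hy (i : Fin n) : φ (y i) ∈ K := IntermediateField.subset_adjoin _ _ ⟨i, rfl⟩
  have h1 : φ (X ⟨1, by omega⟩) ∈ K := hy1 ▸ hy ⟨1, by omega⟩
  have hj (j : Fin n) (h : 2 ≤ (j : ℕ)) : φ (X j) ∈ K := by
    have hmem := K.div_mem (hy j) h1
    rwa [hyj j h, map_mul, mul_div_cancel_left₀ _ (hφ (X_ne_zero _))] at hmem
  have h2 := hj ⟨2, by omega⟩ le_rfl
  have h3 := hj ⟨3, by omega⟩ (Nat.le_succ 2)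
  have hF3 : φ F3 ∈ K :=
    algebraMap_mem_intermediateField_of_mem_supported K (fun j h ↦ hj j h) hF3supp
  have hden : φ (1 + X ⟨2, by omega⟩ ^ 2) ∈ K := by
    rw [map_add, map_one, map_pow]
    exact K.add_mem K.one_mem (pow_mem h2 2)
  have hprod : φ (X ⟨0, by omega⟩) * φ (1 + X ⟨2, by omega⟩ ^ 2) ∈ K := by
    have hmem := K.sub_mem (K.sub_mem (hy ⟨0, by omega⟩)
      (K.mul_mem (pow_mem h1 2) h3)) hF3
    rw [hy0, hF] at hmem
    convert hmem using 1
    simp only [map_add, map_mul, map_pow, map_one]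
    ring
  have h0 : φ (X ⟨0, by omega⟩) ∈ K := by
    have hmem := K.div_mem hprod hden
    rwa [mul_div_cancel_right₀ _ (hφ (one_add_X_sq_ne_zero _))] at hmem
  refine intermediateField_eq_top_of_algebraMap_X_mem (σ := Fin n) K fun i ↦ ?_
  obtain ⟨_ | _ | i, hi⟩ := i
  · exact h0
  · exact h1
  · exact hj _ (Nat.le_add_left 2 i)
end

section
/- The polynomial map Φ : ℂⁿ → ℂⁿ defined by Φ(x) = (y_1(x), y_2(x), …, y_n(x)) is injective on a nonempty Zariski-open subset: there exists a nonzero polynomial g ∈ ℂ[x_1,…,x_n] such that for all points a, b ∈ ℂⁿ with g(a) ≠ 0 and g(b) ≠ 0, the equality Φ(a) = Φ(b) implies a = b. -/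
open MvPolynomial

/-- With `n ≥ 4`, `F₃`, `F`, and `y₁,…,yₙ` as in the context, the
polynomial map `Φ : ℂⁿ → ℂⁿ`, `Φ(x) = (y₁(x),…,yₙ(x))`, is injective on a nonempty
Zariski-open subset: there is a nonzero polynomial `g` such that `Φ(a) = Φ(b)` with
`g(a) ≠ 0 ≠ g(b)` forces `a = b`. -/
theorem statement1 (n : ℕ) (hn : 4 ≤ n)
    (F3 : MvPolynomial (Fin n) ℂ)
    (hF3hom : F3.IsHomogeneous 3)
    (hF3supp : F3 ∈ MvPolynomial.supported ℂ {i : Fin n | 2 ≤ (i : ℕ)})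
    (F : MvPolynomial (Fin n) ℂ)
    (hF : F = X ⟨0, by omega⟩ * X ⟨2, by omega⟩ ^ 2
            + X ⟨1, by omega⟩ ^ 2 * X ⟨3, by omega⟩ + F3)
    (y : Fin n → MvPolynomial (Fin n) ℂ)
    (hy0 : y ⟨0, by omega⟩ = X ⟨0, by omega⟩ + F)
    (hy1 : y ⟨1, by omega⟩ = X ⟨1, by omega⟩)
    (hyj : ∀ j : Fin n, 2 ≤ (j : ℕ) → y j = X ⟨1, by omega⟩ * X j) :
    ∃ g : MvPolynomial (Fin n) ℂ, g ≠ 0 ∧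
      ∀ a b : Fin n → ℂ,
        MvPolynomial.eval a g ≠ 0 → MvPolynomial.eval b g ≠ 0 →
        (∀ i : Fin n, MvPolynomial.eval a (y i) = MvPolynomial.eval b (y i)) →
        a = b := by
  refine ⟨X ⟨1, by omega⟩ * (1 + X ⟨2, by omega⟩ ^ 2), ?_, ?_⟩
  · intro h
    have h2 := congrArg (eval fun _ => (1 : ℂ)) h
    norm_num at h2
  intro a b ha _ hab
  simp only [map_mul, map_add, map_one, map_pow, eval_X] at ha
  obtain ⟨ha1, ha2⟩ := mul_ne_zero_iff.mp ha
  have h1 : a ⟨1, by omega⟩ = b ⟨1, by omega⟩ := by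
    simpa [hy1] using hab ⟨1, by omega⟩
  have hj : ∀ j : Fin n, 2 ≤ (j : ℕ) → a j = b j := by
    intro j hj
    have h := hab j
    simp only [hyj j hj, map_mul, eval_X, ← h1] at h
    exact mul_left_cancel₀ ha1 h
  have h3 : eval a F3 = eval b F3 :=
    eval₂Hom_congr' rfl (fun i hi _ => hj i (mem_supported.mp hF3supp hi)) rfl
  have h0 : a ⟨0, by omega⟩ = b ⟨0, by omega⟩ := by
    have h := hab ⟨0, by omega⟩
    simp only [hy0, hF, map_mul, map_add, map_pow, eval_X, h3, ← h1,
      ← hj ⟨2, by omega⟩ le_rfl, ← hj ⟨3, by omega⟩ (Nat.le_succ 2)] at h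
    refine mul_right_cancel₀ ha2 ?_
    linear_combination h
  funext ⟨i, hi⟩
  match i, hi with
  | 0, _ => exact h0
  | 1, _ => exact h1
  | k + 2, hk => exact hj ⟨k + 2, hk⟩ (Nat.le_add_left 2 k)
end

section
/- Set G := P(y_1,…,y_{n−1}) + y_n + 1 ∈ ℂ[x_1,…,x_n], obtained by substituting the polynomials y_1,…,y_n for the variables of P and adding y_n + 1. Then the quotient ring ℂ[x_1,…,x_n,T]/(T² − G) is an integral domain whose field of fractions is isomorphic as a ℂ-algebra to the rational function field ℂ(z_1,…,z_n) in n variables. (This expresses, in coordinates on the chart ℙⁿ∖H = ℂⁿ, that the double cover used to construct the compactification X is a rational variety.) -/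
open MvPolynomial

/-- Denominators in `e` can be cleared on a whole generated subalgebra once they can be cleared on
the generators. -/
lemma exists_pow_mul_mem_of_mem_adjoin {k R : Type*} [CommRing k] [CommRing R] [Algebra k R]
    (B : Subalgebra k R) {e : R} (he : e ∈ B) {s : Set R}
    (hs : ∀ x ∈ s, ∃ N : ℕ, e ^ N * x ∈ B) {f : R} (hf : f ∈ Algebra.adjoin k s) :
    ∃ N : ℕ, e ^ N * f ∈ B := by
  induction hf using Algebra.adjoin_induction with
  | mem x hx => exact hs x hx
  | algebraMap r => exact ⟨0, by simp⟩
  | add x y _ _ hx hy =>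
    obtain ⟨N, hN⟩ := hx
    obtain ⟨M, hM⟩ := hy
    refine ⟨N + M, ?_⟩
    have : e ^ (N + M) * (x + y) = e ^ M * (e ^ N * x) + e ^ N * (e ^ M * y) := by ring
    rw [this]
    exact add_mem (mul_mem (pow_mem he _) hN) (mul_mem (pow_mem he _) hM)
  | mul x y _ _ hx hy =>
    obtain ⟨N, hN⟩ := hx
    obtain ⟨M, hM⟩ := hy
    refine ⟨N + M, ?_⟩
    have : e ^ (N + M) * (x * y) = (e ^ N * x) * (e ^ M * y) := by ring
    rw [this]
    exact mul_mem hN hM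

/-- A monic polynomial over a domain dividing `a * f` with `a` a nonzero constant divides `f`. -/
lemma Polynomial.Monic.dvd_of_dvd_C_mul {A : Type*} [CommRing A] [IsDomain A]
    {q f : Polynomial A} (hq : q.Monic) {a : A} (ha : a ≠ 0) (h : q ∣ Polynomial.C a * f) :
    q ∣ f := by
  rw [← Polynomial.modByMonic_eq_zero_iff_dvd hq] at h ⊢
  rw [← Polynomial.smul_eq_C_mul, Polynomial.smul_modByMonic] at h
  exact (smul_eq_zero.mp h).resolve_left ha

/-- A birational criterion: if `R ⧸ I` maps to `Frac S` compatibly with a map `S → R`, and becomes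
equal to the image of `S` after inverting a nonzerodivisor `e`, then `R ⧸ I` is a domain with
fraction field `Frac S`. -/
lemma isDomain_quotient_and_fractionRing_equiv {k R S : Type*} [Field k] [CommRing R] [Algebra k R]
    [CommRing S] [IsDomain S] [Algebra k S] (I : Ideal R)
    (φ : R →ₐ[k] FractionRing S) (ψ : S →ₐ[k] R)
    (hφψ : ∀ s, φ (ψ s) = algebraMap S (FractionRing S) s) (hI : ∀ f ∈ I, φ f = 0)
    (e : R) (he : ∀ f, e * f ∈ I → f ∈ I)
    (hclear : ∀ f, ∃ N : ℕ, ∃ s, e ^ N * f - ψ s ∈ I) :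
    IsDomain (R ⧸ I) ∧ Nonempty (FractionRing (R ⧸ I) ≃ₐ[k] FractionRing S) := by
  have hpow : ∀ (N : ℕ) f, e ^ N * f ∈ I → f ∈ I := by
    intro N
    induction N with
    | zero => intro f hf; simpa using hf
    | succ N ih => intro f hf; exact ih f (he _ (by rwa [← mul_assoc, ← pow_succ']))
  have hker : ∀ f, φ f = 0 → f ∈ I := by
    intro f hf
    obtain ⟨N, s, hs⟩ := hclear f
    have h0 := hI _ hs
    rw [map_sub, map_mul, hf, mul_zero, zero_sub, neg_eq_zero, hφψ] at h0
    have hs0 : s = 0 := IsFractionRing.injective S (FractionRing S) (by rw [h0, map_zero])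
    rw [hs0, map_zero, sub_zero] at hs
    exact hpow N f hs
  let Φ : R ⧸ I →ₐ[k] FractionRing S := Ideal.Quotient.liftₐ I φ hI
  have hΦ : ∀ f, Φ (Ideal.Quotient.mk I f) = φ f := fun f => rfl
  have hinj : Function.Injective Φ := by
    rw [injective_iff_map_eq_zero]
    intro a ha
    obtain ⟨f, rfl⟩ := Ideal.Quotient.mk_surjective a
    exact Ideal.Quotient.eq_zero_iff_mem.mpr (hker f ha)
  have hdom : IsDomain (R ⧸ I) := hinj.isDomain Φ.toRingHom
  refine ⟨hdom, ?_⟩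
  let : Algebra (R ⧸ I) (FractionRing S) := Φ.toRingHom.toAlgebra
  have halg : ∀ a, algebraMap (R ⧸ I) (FractionRing S) a = Φ a := fun a => rfl
  have : IsScalarTower k (R ⧸ I) (FractionRing S) :=
    IsScalarTower.of_algebraMap_eq fun r => (Φ.commutes r).symm
  have : FaithfulSMul (R ⧸ I) (FractionRing S) :=
    (faithfulSMul_iff_algebraMap_injective _ _).mpr hinj
  have : IsFractionRing (R ⧸ I) (FractionRing S) := by
    refine IsFractionRing.of_field _ _ fun x => ?_
    obtain ⟨a, b, _, rfl⟩ := IsFractionRing.div_surjective (A := S) x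
    exact ⟨Ideal.Quotient.mk I (ψ a), Ideal.Quotient.mk I (ψ b), by
      rw [halg, halg, hΦ, hΦ, hφψ, hφψ]⟩
  exact ⟨(FractionRing.algEquiv (R ⧸ I) (FractionRing S)).restrictScalars k⟩

/-- The last variable singled out: `k[x₀,…,xₙ] ≃ k[x₀,…,xₙ₋₁][T]`. -/
noncomputable def finSuccEquivLastVar (k : Type*) [CommRing k] (n : ℕ) :
    MvPolynomial (Fin (n + 1)) k ≃ₐ[k] Polynomial (MvPolynomial (Fin n) k) :=
  (renameEquiv k _root_.finSuccEquivLast).trans (optionEquivLeft k (Fin n))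

lemma finSuccEquivLastVar_X_last (k : Type*) [CommRing k] (n : ℕ) :
    finSuccEquivLastVar k n (X (Fin.last n)) = Polynomial.X := by
  simp [finSuccEquivLastVar]

lemma finSuccEquivLastVar_X_of_lt (k : Type*) [CommRing k] {n : ℕ} (i : Fin (n + 1))
    (hi : (i : ℕ) < n) :
    finSuccEquivLastVar k n (X i) = Polynomial.C (X ⟨i, hi⟩) := by
  obtain ⟨j, rfl⟩ : ∃ j : Fin n, i = j.castSucc := ⟨⟨i, hi⟩, rfl⟩
  simp [finSuccEquivLastVar]

/-- In `k[x₀,…,xₙ]`, a nonzero polynomial `e` not involving `xₙ` is a nonzerodivisor modulo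
`xₙ² - g` when `g` does not involve `xₙ`. -/
lemma mem_span_of_mul_mem_span {k : Type*} [Field k] {n : ℕ}
    {e g f : MvPolynomial (Fin (n + 1)) k} (he0 : e ≠ 0)
    (he : e ∈ supported k {i : Fin (n + 1) | (i : ℕ) < n})
    (hg : g ∈ supported k {i : Fin (n + 1) | (i : ℕ) < n})
    (h : e * f ∈ Ideal.span {X (Fin.last n) ^ 2 - g}) :
    f ∈ Ideal.span {X (Fin.last n) ^ 2 - g} := by
  set θ := finSuccEquivLastVar k n with hθ
  have hconst : ∀ p ∈ supported k {i : Fin (n + 1) | (i : ℕ) < n},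
      ∃ a, θ p = Polynomial.C a := by
    intro p hp
    have hle : supported k {i : Fin (n + 1) | (i : ℕ) < n} ≤
        ((Polynomial.CAlgHom (R := k) (A := MvPolynomial (Fin n) k)).range.comap
          (θ : MvPolynomial (Fin (n + 1)) k →ₐ[k] _)) := by
      rw [supported, Algebra.adjoin_le_iff]
      rintro _ ⟨i, hi, rfl⟩
      exact ⟨X ⟨i, hi⟩, (finSuccEquivLastVar_X_of_lt k i hi).symm⟩
    obtain ⟨a, ha⟩ := hle hp
    exact ⟨a, ha.symm⟩
  obtain ⟨a, ha⟩ := hconst e he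
  obtain ⟨b, hb⟩ := hconst g hg
  have ha0 : a ≠ 0 := by
    rintro rfl
    rw [Polynomial.C_0, map_eq_zero_iff θ θ.injective] at ha
    exact he0 ha
  rw [Ideal.mem_span_singleton] at h ⊢
  rw [← map_dvd_iff θ] at h ⊢
  have hq : θ (X (Fin.last n) ^ 2 - g) = Polynomial.X ^ 2 - Polynomial.C b := by
    rw [map_sub, map_pow, hθ, finSuccEquivLastVar_X_last, ← hθ, hb]
  rw [hq] at h ⊢
  rw [map_mul, ha] at h
  exact (Polynomial.monic_X_pow_sub_C b two_ne_zero).dvd_of_dvd_C_mul ha0 h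

/-- Solving `y = z` for the coordinates `x` in a field, with the double cover `T ^ 2 = G` solved by
`T = zₙ`. -/
lemma exists_doubleCover_parametrization (n : ℕ) (hn : 3 < n)
    (F3 : MvPolynomial (Fin (n + 1)) ℂ)
    (hF3supp : F3 ∈ supported ℂ {i : Fin (n + 1) | 2 ≤ (i : ℕ) ∧ (i : ℕ) < n})
    (y : Fin n → MvPolynomial (Fin (n + 1)) ℂ)
    (hy0 : y ⟨0, by omega⟩ = X ⟨0, by omega⟩ + (X ⟨0, by omega⟩ * X ⟨2, by omega⟩ ^ 2
            + X ⟨1, by omega⟩ ^ 2 * X ⟨3, by omega⟩ + F3))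
    (hy1 : y ⟨1, by omega⟩ = X ⟨1, by omega⟩)
    (hyj : ∀ (j : ℕ) (hj : j < n), 2 ≤ j →
        y ⟨j, hj⟩ = X ⟨1, by omega⟩ * X ⟨j, by omega⟩)
    (P : MvPolynomial (Fin (n - 1)) ℂ)
    {K : Type*} [Field K] [Algebra ℂ K] (z : Fin n → K) (hz1 : z ⟨1, by omega⟩ ≠ 0)
    (hz12 : 1 + (z ⟨2, by omega⟩ / z ⟨1, by omega⟩) ^ 2 ≠ 0) :
    ∃ φ : MvPolynomial (Fin (n + 1)) ℂ →ₐ[ℂ] K,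
      φ (X (Fin.last n)) = z ⟨n - 1, by omega⟩ ∧
      (∀ (j : ℕ) (hj : j < n - 1), φ (y ⟨j, by omega⟩) = z ⟨j, by omega⟩) ∧
      φ (X (Fin.last n) ^ 2 - (aeval (fun i : Fin (n - 1) => y ⟨(i : ℕ), by omega⟩) P
          + y ⟨n - 1, by omega⟩ + 1)) = 0 := by
  let w : K := z ⟨n - 1, by omega⟩ ^ 2
    - aeval (fun i : Fin (n - 1) => z ⟨(i : ℕ), by omega⟩) P - 1
  let ξ₀ : Fin (n + 1) → K := fun i =>
    if (i : ℕ) = 1 then z ⟨1, by omega⟩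
    else if (i : ℕ) = n - 1 then w / z ⟨1, by omega⟩
    else if h : (i : ℕ) < n then z ⟨i, h⟩ / z ⟨1, by omega⟩
    else z ⟨n - 1, by omega⟩
  let ξ : Fin (n + 1) → K := fun i =>
    if (i : ℕ) = 0 then
      (z ⟨0, by omega⟩ - z ⟨1, by omega⟩ ^ 2 * ξ₀ ⟨3, by omega⟩ - aeval ξ₀ F3) /
        (1 + (z ⟨2, by omega⟩ / z ⟨1, by omega⟩) ^ 2)
    else ξ₀ i
  let φ : MvPolynomial (Fin (n + 1)) ℂ →ₐ[ℂ] K := aeval ξ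
  have hξ : ∀ i : Fin (n + 1), (i : ℕ) ≠ 0 → ξ i = ξ₀ i := fun i hi => if_neg hi
  have hξ1 : ξ ⟨1, by omega⟩ = z ⟨1, by omega⟩ := by simp [ξ, ξ₀]
  have hξj : ∀ (j : ℕ) (hj : j < n - 1), 2 ≤ j →
      ξ ⟨j, by omega⟩ = z ⟨j, by omega⟩ / z ⟨1, by omega⟩ := by
    intro j hj h2
    simp [ξ, ξ₀, show j ≠ 0 by omega, show j ≠ 1 by omega, show j ≠ n - 1 by omega,
      show j < n by omega]
  have hξlast : ξ (Fin.last n) = z ⟨n - 1, by omega⟩ := by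
    simp [ξ, ξ₀, show n ≠ 0 by omega, show n ≠ 1 by omega, show n ≠ n - 1 by omega]
  have hξw : ξ ⟨n - 1, by omega⟩ = w / z ⟨1, by omega⟩ := by
    simp [ξ, ξ₀, show n - 1 ≠ 0 by omega, show n - 1 ≠ 1 by omega]
  have hF3φ : φ F3 = aeval ξ₀ F3 := by
    have hle : supported ℂ {i : Fin (n + 1) | 2 ≤ (i : ℕ) ∧ (i : ℕ) < n} ≤
        AlgHom.equalizer φ (aeval ξ₀) := by
      rw [supported, Algebra.adjoin_le_iff]
      rintro _ ⟨i, hi, rfl⟩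
      change φ (X i) = aeval ξ₀ (X i)
      rw [aeval_X, aeval_X]
      exact hξ i (by have := hi.1; omega)
    exact hle hF3supp
  have hφ0 : φ (y ⟨0, by omega⟩) = z ⟨0, by omega⟩ := by
    have hξ0 : ξ ⟨0, by omega⟩ * (1 + (z ⟨2, by omega⟩ / z ⟨1, by omega⟩) ^ 2) =
        z ⟨0, by omega⟩ - z ⟨1, by omega⟩ ^ 2 * ξ₀ ⟨3, by omega⟩ - aeval ξ₀ F3 :=
      div_mul_cancel₀ _ hz12
    rw [hy0]
    simp only [map_add, map_mul, map_pow, hF3φ]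
    simp only [φ, aeval_X]
    rw [hξ1, hξj 2 (by omega) le_rfl, hξ ⟨3, by omega⟩ (by simp)]
    linear_combination hξ0
  have hφy : ∀ (j : ℕ) (hj : j < n - 1), φ (y ⟨j, by omega⟩) = z ⟨j, by omega⟩ := by
    intro j hj
    rcases j with _ | _ | j
    · exact hφ0
    · rw [hy1]
      exact (aeval_X _ _).trans hξ1
    · rw [hyj _ _ (by omega), map_mul]
      simp only [φ, aeval_X]
      rw [hξ1, hξj _ hj (by omega)]
      exact mul_div_cancel₀ _ hz1
  have hφw : φ (y ⟨n - 1, by omega⟩) = w := by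
    rw [hyj _ _ (by omega), map_mul]
    simp only [φ, aeval_X]
    rw [hξ1, hξw]
    exact mul_div_cancel₀ _ hz1
  have hφP : φ (aeval (fun i : Fin (n - 1) => y ⟨(i : ℕ), by omega⟩) P) =
      aeval (fun i : Fin (n - 1) => z ⟨(i : ℕ), by omega⟩) P := by
    rw [← AlgHom.comp_apply, comp_aeval]
    congr 2
    funext i
    exact hφy i i.2
  refine ⟨φ, (aeval_X _ _).trans hξlast, hφy, ?_⟩
  rw [map_sub, map_pow, map_add, map_add, hφP, hφw, map_one]
  simp only [φ, aeval_X]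
  rw [hξlast]
  simp only [w]
  ring

/-- A polynomial expression in elements of a subalgebra stays in it. -/
lemma aeval_mem_subalgebra {k σ A : Type*} [CommRing k] [CommRing A] [Algebra k A]
    (B : Subalgebra k A) {v : σ → A} (hv : ∀ i, v i ∈ B) (p : MvPolynomial σ k) :
    aeval v p ∈ B := by
  have hp := (aeval (R := k) v).mem_range_self p
  rw [← Algebra.adjoin_range_eq_range_aeval] at hp
  exact Algebra.adjoin_le (Set.range_subset_iff.mpr hv) hp

lemma clearing_identity {A : Type*} [CommRing A] (a b c d f : A) (M : ℕ) :
    (a * (a ^ 2 + (a * b) ^ 2)) ^ (M + 1) * d = (a ^ 2 + (a * b) ^ 2) ^ M * a ^ 3 *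
      (a ^ M * (d + (d * b ^ 2 + a ^ 2 * c + f)) - a ^ (M + 1) * (a * c) - a ^ M * f) := by
  rw [mul_pow, pow_succ (a ^ 2 + (a * b) ^ 2)]
  ring

/-- All of `ℂ[x, T]` is recovered from the `yⱼ` and `T` after inverting `x₂ (x₂² + (x₂ x₃)²)`. -/
lemma exists_pow_mul_mem_of_coordinates_mem (n : ℕ) (hn : 3 < n)
    (F3 : MvPolynomial (Fin (n + 1)) ℂ)
    (hF3supp : F3 ∈ supported ℂ {i : Fin (n + 1) | 2 ≤ (i : ℕ) ∧ (i : ℕ) < n})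
    (y : Fin n → MvPolynomial (Fin (n + 1)) ℂ)
    (hy0 : y ⟨0, by omega⟩ = X ⟨0, by omega⟩ + (X ⟨0, by omega⟩ * X ⟨2, by omega⟩ ^ 2
            + X ⟨1, by omega⟩ ^ 2 * X ⟨3, by omega⟩ + F3))
    (hy1 : y ⟨1, by omega⟩ = X ⟨1, by omega⟩)
    (hyj : ∀ (j : ℕ) (hj : j < n), 2 ≤ j →
        y ⟨j, hj⟩ = X ⟨1, by omega⟩ * X ⟨j, by omega⟩)
    (B : Subalgebra ℂ (MvPolynomial (Fin (n + 1)) ℂ)) (hBy : ∀ j, y j ∈ B)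
    (hBlast : X (Fin.last n) ∈ B) (f : MvPolynomial (Fin (n + 1)) ℂ) :
    ∃ N : ℕ, (X ⟨1, by omega⟩ * (X ⟨1, by omega⟩ ^ 2
      + (X ⟨1, by omega⟩ * X ⟨2, by omega⟩) ^ 2)) ^ N * f ∈ B := by
  set x1 : MvPolynomial (Fin (n + 1)) ℂ := X ⟨1, by omega⟩
  set x2 : MvPolynomial (Fin (n + 1)) ℂ := X ⟨2, by omega⟩
  have hB1 : x1 ∈ B := hy1 ▸ hBy _
  have hBj : ∀ (j : ℕ) (hj : j < n), 2 ≤ j → x1 * X ⟨j, by omega⟩ ∈ B := fun j hj h2 =>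
    hyj j hj h2 ▸ hBy _
  have hB12 : x1 ^ 2 + (x1 * x2) ^ 2 ∈ B :=
    add_mem (pow_mem hB1 2) (pow_mem (hBj 2 (by omega) le_rfl) 2)
  have hBe : x1 * (x1 ^ 2 + (x1 * x2) ^ 2) ∈ B := mul_mem hB1 hB12
  obtain ⟨M, hM⟩ : ∃ M : ℕ, x1 ^ M * F3 ∈ B := by
    refine exists_pow_mul_mem_of_mem_adjoin B hB1 ?_ hF3supp
    rintro _ ⟨i, hi, rfl⟩
    exact ⟨1, by rw [pow_one]; exact hBj i hi.2 hi.1⟩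
  refine exists_pow_mul_mem_of_mem_adjoin (s := Set.range X) B hBe ?_
    (by rw [adjoin_range_X]; exact Algebra.mem_top)
  rintro _ ⟨⟨i, hi⟩, rfl⟩
  rcases (by omega : i = 0 ∨ i = 1 ∨ (2 ≤ i ∧ i < n) ∨ i = n) with rfl | rfl | ⟨h2, hn'⟩ | rfl
  · refine ⟨M + 1, ?_⟩
    rw [clearing_identity x1 x2 (X ⟨3, by omega⟩) _ F3 M, ← hy0]
    exact mul_mem (mul_mem (pow_mem hB12 M) (pow_mem hB1 3))
      (sub_mem (sub_mem (mul_mem (pow_mem hB1 M) (hBy _))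
        (mul_mem (pow_mem hB1 _) (hBj 3 (by omega) (by omega)))) hM)
  · exact ⟨0, by rw [pow_zero, one_mul]; exact hB1⟩
  · refine ⟨1, ?_⟩
    rw [pow_one, mul_comm x1, mul_assoc]
    exact mul_mem hB12 (hBj i hn' h2)
  · exact ⟨0, by rw [pow_zero, one_mul]; exact hBlast⟩

/-- Let `n ≥ 4`.  In `ℂ[x₁,…,xₙ,T]` (variables `0,…,n-1` are
`x₁,…,xₙ`, the last variable is `T`), let `F₃` be a homogeneous cubic in the
variables `x₃,…,xₙ` only, set `F := x₁·x₃² + x₂²·x₄ + F₃`, and let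
`y₁ := x₁ + F`, `y₂ := x₂`, `yⱼ := x₂·xⱼ` for `3 ≤ j ≤ n`.  For an arbitrary
polynomial `P` in `n - 1` variables set `G := P(y₁,…,y_{n-1}) + yₙ + 1`.  Then
`ℂ[x₁,…,xₙ,T]/(T² − G)` is an integral domain whose field of fractions is
`ℂ`-isomorphic to the rational function field `ℂ(z₁,…,zₙ)`. -/
theorem statement5 (n : ℕ) (hn : 4 ≤ n)
    (F3 : MvPolynomial (Fin (n + 1)) ℂ)
    (hF3hom : F3.IsHomogeneous 3)
    (hF3supp : F3 ∈ MvPolynomial.supported ℂ {i : Fin (n + 1) | 2 ≤ (i : ℕ) ∧ (i : ℕ) < n})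
    (F : MvPolynomial (Fin (n + 1)) ℂ)
    (hF : F = X ⟨0, by omega⟩ * X ⟨2, by omega⟩ ^ 2
            + X ⟨1, by omega⟩ ^ 2 * X ⟨3, by omega⟩ + F3)
    (y : Fin n → MvPolynomial (Fin (n + 1)) ℂ)
    (hy0 : y ⟨0, by omega⟩ = X ⟨0, by omega⟩ + F)
    (hy1 : y ⟨1, by omega⟩ = X ⟨1, by omega⟩)
    (hyj : ∀ j : Fin n, 2 ≤ (j : ℕ) →
        y j = X ⟨1, by omega⟩ * X ⟨(j : ℕ), by omega⟩)
    (P : MvPolynomial (Fin (n - 1)) ℂ)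
    (G : MvPolynomial (Fin (n + 1)) ℂ)
    (hG : G = MvPolynomial.aeval (fun i : Fin (n - 1) => y ⟨(i : ℕ), by omega⟩) P
            + y ⟨n - 1, by omega⟩ + 1)
    (Q : MvPolynomial (Fin (n + 1)) ℂ)
    (hQ : Q = X (Fin.last n) ^ 2 - G) :
    IsDomain (MvPolynomial (Fin (n + 1)) ℂ ⧸ Ideal.span {Q}) ∧
      Nonempty
        (FractionRing (MvPolynomial (Fin (n + 1)) ℂ ⧸ Ideal.span {Q}) ≃ₐ[ℂ]
          FractionRing (MvPolynomial (Fin n) ℂ)) := by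
  subst hF
  have hyj' : ∀ (j : ℕ) (hj : j < n), 2 ≤ j → y ⟨j, hj⟩ = X ⟨1, by omega⟩ * X ⟨j, by omega⟩ :=
    fun j hj h2 => hyj ⟨j, hj⟩ h2
  let z : Fin n → FractionRing (MvPolynomial (Fin n) ℂ) := fun i =>
    algebraMap (MvPolynomial (Fin n) ℂ) _ (X i)
  have hinj := IsFractionRing.injective (MvPolynomial (Fin n) ℂ)
    (FractionRing (MvPolynomial (Fin n) ℂ))
  have hz1 : z ⟨1, by omega⟩ ≠ 0 := fun h =>
    X_ne_zero (R := ℂ) (⟨1, by omega⟩ : Fin n)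
      (hinj (by rw [map_zero]; exact h))
  have hz12 : 1 + (z ⟨2, by omega⟩ / z ⟨1, by omega⟩) ^ 2 ≠ 0 := by
    intro h
    have h1 : z ⟨1, by omega⟩ ^ 2 + z ⟨2, by omega⟩ ^ 2 = 0 := by
      rw [div_pow, one_add_div (pow_ne_zero 2 hz1)] at h
      exact (div_eq_zero_iff.mp h).resolve_right (pow_ne_zero 2 hz1)
    have h2 : (X ⟨1, by omega⟩ ^ 2 + X ⟨2, by omega⟩ ^ 2 : MvPolynomial (Fin n) ℂ) = 0 :=
      hinj (by simpa [z] using h1)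
    have h3 := congrArg (eval fun i : Fin n => if (i : ℕ) = 1 then (1 : ℂ) else 0) h2
    simp at h3
  obtain ⟨φ, hφlast, hφy, hφQ⟩ :=
    exists_doubleCover_parametrization n hn F3 hF3supp y hy0 hy1 hyj' P z hz1 hz12
  rw [← hG, ← hQ] at hφQ
  let η : Fin n → MvPolynomial (Fin (n + 1)) ℂ := fun i =>
    if (i : ℕ) = n - 1 then X (Fin.last n) else y i
  let ψ : MvPolynomial (Fin n) ℂ →ₐ[ℂ] MvPolynomial (Fin (n + 1)) ℂ := aeval η
  have hφψ : ∀ s, φ (ψ s) = algebraMap _ _ s := by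
    have : φ.comp ψ = IsScalarTower.toAlgHom ℂ (MvPolynomial (Fin n) ℂ)
        (FractionRing (MvPolynomial (Fin n) ℂ)) := by
      ext i
      rw [AlgHom.comp_apply]
      simp only [ψ, aeval_X, η]
      split_ifs with h
      · have hi : i = ⟨n - 1, by omega⟩ := Fin.ext h
        rw [hφlast, hi]
        rfl
      · exact hφy i (by omega)
    intro s
    exact DFunLike.congr_fun this s
  let I : Ideal (MvPolynomial (Fin (n + 1)) ℂ) := Ideal.span {Q}
  let x1 : MvPolynomial (Fin (n + 1)) ℂ := X ⟨1, by omega⟩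
  let x2 : MvPolynomial (Fin (n + 1)) ℂ := X ⟨2, by omega⟩
  let e : MvPolynomial (Fin (n + 1)) ℂ := x1 * (x1 ^ 2 + (x1 * x2) ^ 2)
  have hsupp : ∀ i : Fin (n + 1), (i : ℕ) < n →
      (X i : MvPolynomial (Fin (n + 1)) ℂ) ∈ supported ℂ {i : Fin (n + 1) | (i : ℕ) < n} :=
    fun i hi => Algebra.subset_adjoin ⟨i, hi, rfl⟩
  have hF3supp' : F3 ∈ supported ℂ {i : Fin (n + 1) | (i : ℕ) < n} :=
    supported_mono (fun _ hi => And.right hi) hF3supp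
  have hysupp : ∀ j : Fin n, y j ∈ supported ℂ {i : Fin (n + 1) | (i : ℕ) < n} := by
    rintro ⟨j, hj⟩
    rcases j with _ | _ | j
    · rw [hy0]
      refine add_mem (hsupp _ hj) (add_mem (add_mem (mul_mem (hsupp _ hj) (pow_mem (hsupp _ ?_) 2))
        (mul_mem (pow_mem (hsupp _ ?_) 2) (hsupp _ ?_))) hF3supp')
      · change 2 < n
        omega
      · change 1 < n
        omega
      · change 3 < n
        omega
    · rw [hy1]
      exact hsupp _ hj
    · rw [hyj' _ _ (by omega)]
      exact mul_mem (hsupp _ (show 1 < n by omega)) (hsupp _ hj)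
  have hGsupp : G ∈ supported ℂ {i : Fin (n + 1) | (i : ℕ) < n} := by
    rw [hG]
    exact add_mem (add_mem (aeval_mem_subalgebra _ (fun i => hysupp _) P) (hysupp _)) (one_mem _)
  have hx1supp := hsupp ⟨1, by omega⟩ (show 1 < n by omega)
  have hx2supp := hsupp ⟨2, by omega⟩ (show 2 < n by omega)
  have hesupp : e ∈ supported ℂ {i : Fin (n + 1) | (i : ℕ) < n} :=
    mul_mem hx1supp (add_mem (pow_mem hx1supp 2) (pow_mem (mul_mem hx1supp hx2supp) 2))
  have he0 : e ≠ 0 := by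
    intro h
    have h3 := congrArg (eval fun i : Fin (n + 1) => if (i : ℕ) = 1 then (1 : ℂ) else 0) h
    simp [e, x1, x2] at h3
  let B : Subalgebra ℂ (MvPolynomial (Fin (n + 1)) ℂ) :=
    ((Ideal.Quotient.mkₐ ℂ I).comp ψ).range.comap (Ideal.Quotient.mkₐ ℂ I)
  have hBψ : ∀ s, ψ s ∈ B := fun s => ⟨s, rfl⟩
  have hBI : ∀ f ∈ I, f ∈ B := fun f hf =>
    ⟨0, by
      have := Ideal.Quotient.eq_zero_iff_mem.mpr hf
      simpa using this.symm⟩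
  have hBlast : X (Fin.last n) ∈ B := by
    have := hBψ (X ⟨n - 1, by omega⟩)
    simpa [ψ, η] using this
  have hBy : ∀ (j : ℕ) (hj : j < n - 1), y ⟨j, by omega⟩ ∈ B := by
    intro j hj
    have := hBψ (X ⟨j, by omega⟩)
    simpa [ψ, η, show j ≠ n - 1 by omega] using this
  have hBP : aeval (fun i : Fin (n - 1) => y ⟨(i : ℕ), by omega⟩) P ∈ B :=
    aeval_mem_subalgebra B (fun i : Fin (n - 1) => hBy i i.2) P
  have hByn : y ⟨n - 1, by omega⟩ ∈ B := by
    have : y ⟨n - 1, by omega⟩ = X (Fin.last n) ^ 2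
        - aeval (fun i : Fin (n - 1) => y ⟨(i : ℕ), by omega⟩) P - 1 - Q := by
      rw [hQ, hG]
      ring
    rw [this]
    exact sub_mem (sub_mem (sub_mem (pow_mem hBlast 2) hBP) (one_mem _))
      (hBI _ (Ideal.mem_span_singleton_self Q))
  have hBy' : ∀ j, y j ∈ B := by
    rintro ⟨j, hj⟩
    rcases (by omega : j < n - 1 ∨ j = n - 1) with h | rfl
    · exact hBy j h
    · exact hByn
  refine isDomain_quotient_and_fractionRing_equiv (k := ℂ) (S := MvPolynomial (Fin n) ℂ) I φ ψ hφψ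
    ?_ e ?_ ?_
  · intro f hf
    obtain ⟨c, rfl⟩ := Ideal.mem_span_singleton.mp hf
    rw [map_mul, hφQ, zero_mul]
  · intro f hf
    simp only [I, hQ] at hf ⊢
    exact mem_span_of_mul_mem_span he0 hesupp hGsupp hf
  · intro f
    obtain ⟨N, s, hs⟩ :=
      exists_pow_mul_mem_of_coordinates_mem n hn F3 hF3supp y hy0 hy1 hyj' B hBy' hBlast f
    exact ⟨N, s, Ideal.Quotient.eq.mp hs.symm⟩
end
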